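/- arXiv:2407.18286 — 2 statements merged into one kernel-verified Lean document; each statement's English description precedes it below -/
import Mathlib

section
/- Let h and k be coprime natural numbers with h ≥ 2 and k ≥ 2, and let S be an additive submonoid of ℕ containing both h and k. Then the complement ℕ \ S is finite and has at most (h − 1)(k − 1)/2 elements. Consequently, if ℕ \ S has exactly g elements and g > (h − 1)(k − 1)/2, then h and k cannot both lie in S. -/
/-- Every gap of a submonoid of `ℕ` containing coprime `h` and `k` is reflected by
`n ↦ (h - 1) * (k - 1) - 1 - n` to an element of the submonoid. -/
theorem AddSubmonoid.exists_mem_add_add_one_eq_of_notMem {h k : ℕ} (hh : 1 ≤ h) (hk : 1 ≤ k)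
    (hcop : Nat.Coprime h k) {S : AddSubmonoid ℕ} (hhS : h ∈ S) (hkS : k ∈ S) {n : ℕ}
    (hn : n ∉ S) : ∃ m ∈ S, n + m + 1 = (h - 1) * (k - 1) := by
  have comb_mem (a b : ℕ) : a * h + b * k ∈ S := by
    simpa only [smul_eq_mul] using S.add_mem (S.nsmul_mem hhS a) (S.nsmul_mem hkS b)
  obtain ⟨a, hak, ha⟩ : ∃ a < k, a * h ≡ n [MOD k] := by
    simpa only [Nat.ModEq, mul_comm h] using Nat.exists_mul_mod_eq_of_coprime n hcop (by lia)
  rcases le_or_gt (a * h) n with hle | hlt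
  · obtain ⟨b, hb⟩ := (Nat.modEq_iff_dvd' hle).mp ha
    refine absurd (comb_mem a b) ?_
    rwa [mul_comm b, ← hb, Nat.add_sub_cancel' hle]
  · obtain ⟨c, hc⟩ := (Nat.modEq_iff_dvd' hlt.le).mp ha.symm
    have hc_pos : 1 ≤ c := Nat.pos_of_ne_zero (by rintro rfl; lia)
    refine ⟨(k - 1 - a) * h + (c - 1) * k, comb_mem _ _, ?_⟩
    have hsum : n + k * c = a * h := by lia
    zify [hh, hk, hc_pos, show a ≤ k - 1 by lia] at hsum ⊢
    linear_combination hsum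

/-- If `h, k ≥ 2` are coprime and `S` is an additive submonoid of `ℕ` containing `h` and
`k`, then the complement of `S` is finite with at most `(h-1)*(k-1)/2` elements; hence if
the complement has exactly `g` elements with `g > (h-1)*(k-1)/2`, then `h` and `k` cannot
both lie in `S`. -/
theorem jenkins_gap_criterion (h k : ℕ) (hh : 2 ≤ h) (hk : 2 ≤ k)
    (hcop : Nat.Coprime h k) (S : AddSubmonoid ℕ) (hhS : h ∈ S) (hkS : k ∈ S) :
    (((S : Set ℕ)ᶜ).Finite ∧ ((S : Set ℕ)ᶜ).ncard ≤ (h - 1) * (k - 1) / 2) ∧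
    (∀ g : ℕ, ((S : Set ℕ)ᶜ).ncard = g → (h - 1) * (k - 1) / 2 < g →
      ¬(h ∈ S ∧ k ∈ S)) := by
  classical
  have reflect {n : ℕ} (hn : n ∉ S) : ∃ m ∈ S, n + m + 1 = (h - 1) * (k - 1) :=
    AddSubmonoid.exists_mem_add_add_one_eq_of_notMem (by lia) (by lia) hcop hhS hkS hn
  set M := (h - 1) * (k - 1)
  have hgaps : (S : Set ℕ)ᶜ = ((Finset.range M).filter (· ∉ S) : Finset ℕ) := by
    ext n
    simp only [Set.mem_compl_iff, SetLike.mem_coe, Finset.coe_filter, Finset.mem_range,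
      Set.mem_ofPred_eq]
    refine ⟨fun hn => ⟨?_, hn⟩, And.right⟩
    obtain ⟨m, -, hm⟩ := reflect hn
    lia
  have hle : ((Finset.range M).filter (· ∉ S)).card ≤ ((Finset.range M).filter (· ∈ S)).card := by
    refine Finset.card_le_card_of_injOn (fun n => M - 1 - n) (fun n hn => ?_)
      (fun n hn n' hn' hnn' => ?_)
    · obtain ⟨m, hmS, hm⟩ := reflect (Finset.mem_filter.mp hn).2
      obtain rfl : M - 1 - n = m := by lia
      exact Finset.mem_filter.mpr ⟨Finset.mem_range.mpr (by lia), hmS⟩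
    · have := Finset.mem_range.mp (Finset.mem_filter.mp hn).1
      have := Finset.mem_range.mp (Finset.mem_filter.mp hn').1
      lia
  have hcard := Finset.card_filter_add_card_filter_not (s := Finset.range M) (· ∈ S)
  rw [Finset.card_range] at hcard
  have hbound : ((S : Set ℕ)ᶜ).ncard ≤ M / 2 := by
    rw [hgaps, Set.ncard_coe_finset]
    lia
  exact ⟨⟨hgaps ▸ Finset.finite_toSet _, hbound⟩, fun g hg hlt => by lia⟩
end

section
/- Let h and k be coprime natural numbers with h ≥ 2 and k ≥ 2, and let S be the additive submonoid of ℕ generated by {h, k}. Then the complement ℕ \ S is finite and has exactly (h − 1)(k − 1)/2 elements. -/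
/-- The numerical semigroup generated by two coprime integers `h, k ≥ 2` is symmetric: reflection
in its Frobenius number `h * k - h - k` exchanges elements and gaps. -/
theorem sub_mem_closure_pair_iff {h k n : ℕ} (hh : 2 ≤ h) (hk : 2 ≤ k) (hcop : Nat.Coprime h k)
    (hn : n ≤ h * k - h - k) :
    h * k - h - k - n ∈ AddSubmonoid.closure ({h, k} : Set ℕ) ↔
      n ∉ AddSubmonoid.closure ({h, k} : Set ℕ) := by
  have hF := frobeniusNumber_iff.mp (frobeniusNumber_pair hcop hh hk)
  have hhk : h + k ≤ h * k := Nat.add_le_mul hh hk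
  constructor
  · intro h₁ h₂
    exact hF.1 (by simpa [Nat.sub_add_cancel hn] using add_mem h₁ h₂)
  · intro hgap
    obtain ⟨a, b, hab⟩ := (AddSubmonoid.mem_closure_pair ..).mp (hF.2 (n + h * k) (by omega))
    simp only [AddSubmonoid.mem_closure_pair, smul_eq_mul] at hab hgap ⊢
    have ha : a < k := by
      by_contra! hka
      obtain ⟨c, rfl⟩ := Nat.exists_eq_add_of_le hka
      exact hgap ⟨c, b, by linarith⟩
    have hb : b < h := by
      by_contra! hhb
      obtain ⟨c, rfl⟩ := Nat.exists_eq_add_of_le hhb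
      exact hgap ⟨a, c, by linarith⟩
    refine ⟨k - 1 - a, h - 1 - b, ?_⟩
    obtain ⟨c, rfl⟩ := Nat.exists_eq_add_of_lt ha
    obtain ⟨d, rfl⟩ := Nat.exists_eq_add_of_lt hb
    rw [show a + c + 1 - 1 - a = c by omega, show b + d + 1 - 1 - b = d by omega]
    zify [hn, Nat.le_sub_of_add_le' hhk, (Nat.le_add_right _ _).trans hhk] at hab ⊢
    linarith

/-- Sylvester's theorem: if `h, k ≥ 2` are coprime, the complement of the additive
submonoid of `ℕ` generated by `{h, k}` is finite with exactly `(h-1)*(k-1)/2` elements. -/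
theorem sylvester_gap_count (h k : ℕ) (hh : 2 ≤ h) (hk : 2 ≤ k)
    (hcop : Nat.Coprime h k) :
    (((AddSubmonoid.closure {h, k} : AddSubmonoid ℕ) : Set ℕ)ᶜ).Finite ∧
    (((AddSubmonoid.closure {h, k} : AddSubmonoid ℕ) : Set ℕ)ᶜ).ncard =
      (h - 1) * (k - 1) / 2 := by
  classical
  have hF := frobeniusNumber_iff.mp (frobeniusNumber_pair hcop hh hk)
  have hsymm := fun n ↦ sub_mem_closure_pair_iff (n := n) hh hk hcop
  have hhk : h + k ≤ h * k := Nat.add_le_mul hh hk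
  have hsize : (h - 1) * (k - 1) = h * k - h - k + 1 := by
    zify [Nat.le_sub_of_add_le' hhk, (Nat.le_add_right _ _).trans hhk, one_le_two.trans hh,
      one_le_two.trans hk]
    ring
  rw [hsize]
  generalize h * k - h - k = F at hF hsymm
  generalize AddSubmonoid.closure ({h, k} : Set ℕ) = S at hF hsymm
  have hgaps : (S : Set ℕ)ᶜ = ((Finset.range (F + 1)).filter (· ∉ S) : Finset ℕ) := by
    ext n
    have := hF.2 n
    simp only [Set.mem_compl_iff, SetLike.mem_coe, Finset.coe_filter, Finset.mem_range,
      Set.mem_ofPred_eq]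
    grind
  have hrefl : ((Finset.range (F + 1)).filter (· ∈ S)).card =
      ((Finset.range (F + 1)).filter (· ∉ S)).card := by
    refine Finset.card_nbij' (F - ·) (F - ·) ?_ ?_ ?_ ?_ <;> intro n hn <;>
      simp only [Finset.coe_filter, Finset.mem_range, Set.mem_ofPred_eq] at hn ⊢
    · have := hsymm n (by omega)
      exact ⟨by omega, fun hm ↦ this.mp hm hn.2⟩
    · exact ⟨by omega, (hsymm n (by omega)).mpr hn.2⟩
    · omega
    · omega
  have hsum := Finset.card_filter_add_card_filter_not (s := Finset.range (F + 1)) (· ∈ S)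
  rw [Finset.card_range] at hsum
  rw [hgaps, Set.ncard_coe_finset]
  exact ⟨Finset.finite_toSet _, by omega⟩
end
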